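/- arXiv:math/0608360 — 4 statements merged into one kernel-verified Lean document; each statement's English description precedes it below -/
import Mathlib

section
/- Correspondence with the constrained chip-firing game: Let G be a graph, let K^+ = Σ_{v∈V(G)} (deg(v) − 1)(v), and let D ∈ Div(G) satisfy D(v) ≤ deg(v) − 1 for all v ∈ V(G); set D* = K^+ − D. Then D is linearly equivalent to an effective divisor if and only if there is a finite sequence D* = E_0, E_1, …, E_k such that for each 0 ≤ i < k there is a vertex u_i with E_i(u_i) ≥ deg(u_i) and E_{i+1} = E_i − Δ(χ_{{u_i}}), and E_k(v) ≤ deg(v) − 1 for all v ∈ V(G) (i.e., a legal sequence of firings starting from D* that terminates with no vertex able to fire). -/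
open Finset

variable {V : Type}

/-- Degree of a vertex in the multigraph with edge multiplicities `m`. -/
def mdeg [Fintype V] (m : V → V → ℕ) (v : V) : ℕ := ∑ w, m v w

/-- The Laplacian of an integer-valued function on the vertices. -/
def laplacian [Fintype V] (m : V → V → ℕ) (f : V → ℤ) : V → ℤ :=
  fun v => (mdeg m v : ℤ) * f v - ∑ w, (m v w : ℤ) * f w

/-- Linear equivalence of divisors. -/
def LinEquiv [Fintype V] (m : V → V → ℕ) (D D' : V → ℤ) : Prop :=
  ∃ f : V → ℤ, D - D' = laplacian m f

/-- A divisor is effective if it is nonnegative everywhere. -/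
def Effective (D : V → ℤ) : Prop := ∀ v, 0 ≤ D v

/-- Degree of a divisor. -/
def divDeg [Fintype V] (D : V → ℤ) : ℤ := ∑ v, D v

/-- `D` is linearly equivalent to some effective divisor. -/
def Winnable [Fintype V] (m : V → V → ℕ) (D : V → ℤ) : Prop :=
  ∃ E, Effective E ∧ LinEquiv m D E

/-- Number of edges of the multigraph. -/
def edgeCount [Fintype V] (m : V → V → ℕ) : ℤ := (∑ v, ∑ w, (m v w : ℤ)) / 2

/-- The genus `g = |E| - |V| + 1`. -/
def genus [Fintype V] (m : V → V → ℕ) : ℤ := edgeCount m - Fintype.card V + 1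

/-- `m` describes a graph: symmetric, loopless, and connected. -/
def IsGraph [Fintype V] (m : V → V → ℕ) : Prop :=
  (∀ v w, m v w = m w v) ∧ (∀ v, m v v = 0) ∧
  (SimpleGraph.fromRel (fun v w => 0 < m v w)).Connected


theorem laplacian_add_aux [Fintype V] (m : V → V → ℕ) (f g : V → ℤ) :
    laplacian m (f + g) = laplacian m f + laplacian m g := by
  funext v
  simp only [laplacian, Pi.add_apply, mul_add, Finset.sum_add_distrib]
  ring

theorem laplacian_neg_aux [Fintype V] (m : V → V → ℕ) (f : V → ℤ) :
    laplacian m (-f) = -laplacian m f := by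
  funext v
  simp only [laplacian, Pi.neg_apply, mul_neg, Finset.sum_neg_distrib]
  ring

theorem laplacian_const_aux [Fintype V] (m : V → V → ℕ) (c : ℤ) :
    laplacian m (fun _ => c) = 0 := by
  funext v
  simp [laplacian, mdeg, Finset.sum_mul]

theorem legal_terminates_aux [Fintype V] [DecidableEq V] (m : V → V → ℕ) (n : ℕ) :
    ∀ (S g : V → ℤ), (∀ v, 0 ≤ g v) → ∑ v, g v = (n : ℤ) →
      (∀ v, (S - laplacian m g) v ≤ (mdeg m v : ℤ) - 1) →
      ∃ (k : ℕ) (s : ℕ → V → ℤ), s 0 = S ∧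
        (∀ i, i < k → ∃ u : V, (mdeg m u : ℤ) ≤ s i u ∧
          s (i + 1) = s i - laplacian m (fun w => if w = u then 1 else 0)) ∧
        (∀ v, s k v ≤ (mdeg m v : ℤ) - 1) := by
  induction n with
  | zero =>
    intro S g hg hsum hS
    have h0 : g = fun _ => 0 := by
      funext v
      exact (Finset.sum_eq_zero_iff_of_nonneg (fun v _ => hg v)).1
        (by simpa using hsum) v (Finset.mem_univ v)
    rw [h0, laplacian_const_aux, sub_zero] at hS
    exact ⟨0, fun _ => S, rfl, fun i hi => absurd hi (Nat.not_lt_zero i), hS⟩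
  | succ n ih =>
    intro S g hg hsum hS
    by_cases hst : ∀ v, S v ≤ (mdeg m v : ℤ) - 1
    · exact ⟨0, fun _ => S, rfl, fun i hi => absurd hi (Nat.not_lt_zero i), hst⟩
    obtain ⟨u, hu⟩ := not_forall.1 hst
    have hu' : (mdeg m u : ℤ) ≤ S u := by omega
    have hgu : 1 ≤ g u := by
      by_contra hlt
      have h0 : g u = 0 := by have := hg u; omega
      have h1 := hS u
      have h2 : 0 ≤ ∑ w, (m u w : ℤ) * g w :=
        Finset.sum_nonneg (fun w _ => mul_nonneg (Int.natCast_nonneg _) (hg w))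
      simp only [Pi.sub_apply, laplacian, h0, mul_zero] at h1
      omega
    set e : V → ℤ := fun w => if w = u then 1 else 0 with he
    have hsplit : laplacian m g = laplacian m e + laplacian m (g + -e) := by
      rw [← laplacian_add_aux]; congr 1; abel
    obtain ⟨k, s, hs0, hs, hk⟩ := ih (S - laplacian m e) (g + -e)
      (by
        intro v
        simp only [he, Pi.add_apply, Pi.neg_apply]
        have := hg v
        split_ifs with h
        · subst h; omega
        · omega)
      (by
        simp only [Pi.add_apply, Pi.neg_apply, Finset.sum_add_distrib, Finset.sum_neg_distrib,
          hsum, he]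
        simp)
      (by
        rw [hsplit, ← sub_sub] at hS
        exact hS)
    refine ⟨k + 1, fun i => Nat.casesOn i S s, rfl, ?_, hk⟩
    intro i hi
    cases i with
    | zero => exact ⟨u, hu', hs0⟩
    | succ j => exact hs j (by omega)

theorem constrained_chip_firing_correspondence [Fintype V] [DecidableEq V]
    (m : V → V → ℕ) (hm : IsGraph m) (D : V → ℤ)
    (hD : ∀ v, D v ≤ (mdeg m v : ℤ) - 1) :
    Winnable m D ↔
      ∃ (k : ℕ) (s : ℕ → V → ℤ),
        s 0 = (fun v => ((mdeg m v : ℤ) - 1) - D v) ∧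
        (∀ i, i < k → ∃ u : V, (mdeg m u : ℤ) ≤ s i u ∧
          s (i + 1) = s i - laplacian m (fun w => if w = u then 1 else 0)) ∧
        (∀ v, s k v ≤ (mdeg m v : ℤ) - 1) := by
  constructor
  · rintro ⟨E, hE, f, hf⟩
    set g : V → ℤ := -f + (fun _ => ∑ w, |f w|) with hgdef
    have hg : ∀ v, 0 ≤ g v := by
      intro v
      have h1 : |f v| ≤ ∑ w, |f w| :=
        Finset.single_le_sum (f := fun w => |f w|) (fun w _ => abs_nonneg _) (Finset.mem_univ v)
      have h2 := le_abs_self (f v)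
      simp only [hgdef, Pi.add_apply, Pi.neg_apply]
      omega
    obtain ⟨n, hn⟩ := Int.eq_ofNat_of_zero_le (Finset.sum_nonneg (fun v (_ : v ∈ univ) => hg v))
    refine legal_terminates_aux m n _ g hg hn ?_
    intro v
    have h1 := congrFun hf v
    have h2 := hE v
    rw [hgdef, laplacian_add_aux, laplacian_const_aux, laplacian_neg_aux]
    simp only [Pi.sub_apply, Pi.add_apply, Pi.neg_apply, Pi.zero_apply] at h1 ⊢
    omega
  · rintro ⟨k, s, hs0, hs, hk⟩
    have key : ∀ i, i ≤ k → ∃ g : V → ℤ, s i = s 0 - laplacian m g := by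
      intro i
      induction i with
      | zero => intro _; exact ⟨fun _ => 0, by rw [laplacian_const_aux, sub_zero]⟩
      | succ i ih =>
        intro hi
        obtain ⟨g, hg⟩ := ih (by omega)
        obtain ⟨u, _, hu⟩ := hs i (by omega)
        exact ⟨g + _, by rw [hu, hg, laplacian_add_aux, sub_sub]⟩
    obtain ⟨g, hg⟩ := key k le_rfl
    refine ⟨D + laplacian m g, ?_, -g, ?_⟩
    · intro v
      have h1 := congrFun hg v
      have h2 := hk v
      rw [hs0] at h1
      simp only [Pi.sub_apply, Pi.add_apply] at h1 ⊢
      omega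
    · rw [laplacian_neg_aux]; abel
end

section
/- Reduced-critical correspondence: Let G be a graph with n = |V(G)| vertices, fix a base vertex v0 ∈ V(G), and let K^+ = Σ_{v∈V(G)} (deg(v) − 1)(v). A divisor D ∈ Div(G) is v0-reduced if and only if the divisor D* = K^+ − D is v0-critical. -/
open Finset

variable {V : Type}

/-- `outdeg_A(v)`: the number of edges from `v` to vertices outside `A`. -/
def outdeg [Fintype V] [DecidableEq V] (m : V → V → ℕ) (A : Finset V) (v : V) : ℕ :=
  ∑ w ∈ Aᶜ, m v w

/-- A divisor is `v0`-reduced if it is nonnegative away from `v0` and every nonempty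
set `A` of vertices avoiding `v0` contains a vertex `v` with `D v < outdeg_A(v)`. -/
def Reduced [Fintype V] [DecidableEq V] (m : V → V → ℕ) (v0 : V) (D : V → ℤ) : Prop :=
  (∀ v, v ≠ v0 → 0 ≤ D v) ∧
  ∀ A : Finset V, A.Nonempty → v0 ∉ A → ∃ v ∈ A, D v < (outdeg m A v : ℤ)

open Classical in
/-- `D` is `v0`-critical with respect to the ordering `ord 0 = v0, ord 1, …, ord (n-1)`
of the vertices: `0 ≤ D v ≤ deg v - 1` for `v ≠ v0`, and for every `1 ≤ k ≤ n - 1`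
the divisor `D_k = D - Δ(χ_{B_k})`, with `B_k = {ord 0, …, ord k}`, is nonnegative
away from `v0`. -/
def CriticalWrt [Fintype V] (m : V → V → ℕ) (v0 : V) (ord : ℕ → V) (D : V → ℤ) : Prop :=
  (∀ v, v ≠ v0 → 0 ≤ D v ∧ D v ≤ (mdeg m v : ℤ) - 1) ∧
  ∀ k, 1 ≤ k → k ≤ Fintype.card V - 1 → ∀ v, v ≠ v0 →
    0 ≤ (D - laplacian m (fun w => if ∃ i ≤ k, ord i = w then 1 else 0)) v

/-- `D` is `v0`-critical if it is `v0`-critical with respect to some enumeration of the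
vertices starting at `v0`. -/
def Critical [Fintype V] (m : V → V → ℕ) (v0 : V) (D : V → ℤ) : Prop :=
  ∃ ord : ℕ → V, ord 0 = v0 ∧ (∀ v : V, ∃! i, i < Fintype.card V ∧ ord i = v) ∧
    CriticalWrt m v0 ord D

lemma aux_sum [Fintype V] (m : V → V → ℕ) (v : V) (P : V → Prop) [DecidablePred P] (S : Finset V)
    (h : ∀ w, P w ↔ w ∈ S) :
    ∑ w, (m v w : ℤ) * (if P w then 1 else 0) = ∑ w ∈ S, (m v w : ℤ) := by
  simp only [mul_ite, mul_one, mul_zero]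
  rw [← Finset.sum_filter]
  congr 1
  ext w
  simp [h]

lemma aux_order [Fintype V] [DecidableEq V] (m : V → V → ℕ) (v0 : V) (D : V → ℤ)
    (h : Reduced m v0 D) (k : ℕ) : k < Fintype.card V →
    ∃ ord : ℕ → V, ord 0 = v0 ∧ (∀ i ≤ k, ∀ j ≤ k, ord i = ord j → i = j) ∧
      ∀ i, 1 ≤ i → i ≤ k → D (ord i) < ∑ w ∈ (range i).image ord, (m (ord i) w : ℤ) := by
  induction k with
  | zero =>
    intro _
    refine ⟨fun _ => v0, rfl, ?_, ?_⟩
    · intros; omega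
    · intros; omega
  | succ k ih =>
    intro hk
    obtain ⟨ord, h0, hinj, hD⟩ := ih (by omega)
    have hne : (((range (k+1)).image ord)ᶜ).Nonempty := by
      rw [← Finset.card_pos, Finset.card_compl]
      have := Finset.card_image_le (s := range (k+1)) (f := ord)
      rw [Finset.card_range] at this
      omega
    obtain ⟨v, hv, hlt⟩ := h.2 _ hne (by
      simp only [mem_compl, not_not, mem_image, mem_range]
      exact ⟨0, by omega, h0⟩)
    simp only [mem_compl, mem_image, mem_range, not_exists, not_and] at hv
    rw [outdeg, compl_compl] at hlt
    push_cast at hlt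
    have himg : ∀ i ≤ k+1, (range i).image (Function.update ord (k+1) v) =
        (range i).image ord := by
      intro i hi
      apply Finset.image_congr
      intro j hj
      have : j < i := by simpa using hj
      exact Function.update_of_ne (by omega) _ _
    refine ⟨Function.update ord (k+1) v, ?_, ?_, ?_⟩
    · rw [Function.update_of_ne (by omega)]; exact h0
    · intro i hi j hj hij
      by_cases h1 : i = k+1 <;> by_cases h2 : j = k+1
      · omega
      · subst h1
        rw [Function.update_self, Function.update_of_ne h2] at hij
        exact absurd hij.symm (hv j (by omega))
      · subst h2
        rw [Function.update_self, Function.update_of_ne h1] at hij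
        exact absurd hij (hv i (by omega))
      · rw [Function.update_of_ne h1, Function.update_of_ne h2] at hij
        exact hinj i (by omega) j (by omega) hij
    · intro i hi hik
      rw [himg i hik]
      by_cases h1 : i = k+1
      · subst h1
        rw [Function.update_self]; exact hlt
      · rw [Function.update_of_ne h1]
        exact hD i hi (by omega)

lemma aux_lap [Fintype V] [DecidableEq V] (m : V → V → ℕ) (ord : ℕ → V) (D : V → ℤ) (k : ℕ)
    (v : V) (χ : V → ℤ)
    (hχ : ∀ w, χ w = if w ∈ (range (k+1)).image ord then 1 else 0) :
    ((fun v => ((mdeg m v : ℤ) - 1) - D v) - laplacian m χ) v =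
      (mdeg m v : ℤ) - 1 - D v
        - (mdeg m v : ℤ) * (if v ∈ (range (k+1)).image ord then 1 else 0)
        + ∑ w ∈ (range (k+1)).image ord, (m v w : ℤ) := by
  have := aux_sum m v (fun w => w ∈ (range (k+1)).image ord) ((range (k+1)).image ord)
    (by intro w; rfl)
  rw [Pi.sub_apply, laplacian, ← this]
  simp only [hχ]
  ring

theorem reduced_iff_critical [Fintype V] [DecidableEq V] (m : V → V → ℕ)
    (hm : IsGraph m) (v0 : V) (D : V → ℤ) :
    Reduced m v0 D ↔ Critical m v0 (fun v => ((mdeg m v : ℤ) - 1) - D v) := by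
  obtain ⟨-, hloop, -⟩ := hm
  have hcard : 0 < Fintype.card V := Fintype.card_pos_iff.mpr ⟨v0⟩
  constructor
  · intro h
    obtain ⟨ord, h0, hinj, hD⟩ := aux_order m v0 D h (Fintype.card V - 1) (by omega)
    have hex : ∀ v : V, ∃ i, i < Fintype.card V ∧ ord i = v := by
      have : (range (Fintype.card V)).image ord = univ := by
        apply Finset.eq_univ_of_card
        rw [Finset.card_image_of_injOn, Finset.card_range]
        intro i hi j hj hij
        simp only [coe_range, Set.mem_Iio] at hi hj
        exact hinj i (by omega) j (by omega) hij
      intro v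
      have hv : v ∈ (range (Fintype.card V)).image ord := by rw [this]; simp
      simpa using hv
    have hup : ∀ v, v ≠ v0 → D v ≤ (mdeg m v : ℤ) - 1 := by
      intro v hv
      obtain ⟨i, hi, rfl⟩ := hex v
      have hi0 : i ≠ 0 := by rintro rfl; exact hv h0
      have h1 := hD i (by omega) (by omega)
      have h2 : ∑ w ∈ (range i).image ord, (m (ord i) w : ℤ) ≤ ∑ w, (m (ord i) w : ℤ) :=
        Finset.sum_le_sum_of_subset_of_nonneg (Finset.subset_univ _) (by intros; positivity)
      rw [mdeg]; push_cast; omega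
    refine ⟨ord, h0, ?_, ?_, ?_⟩
    · intro v
      obtain ⟨i, hi, hv⟩ := hex v
      refine ⟨i, ⟨hi, hv⟩, ?_⟩
      rintro j ⟨hj, hjv⟩
      exact hinj j (by omega) i (by omega) (hjv.trans hv.symm)
    · intro v hv
      have := hup v hv
      have := h.1 v hv
      constructor <;> dsimp only <;> omega
    · intro k hk hkn v hv
      rw [aux_lap m ord D k v]
      swap
      · intro w; simp [Order.lt_add_one_iff]
      have hnn : 0 ≤ ∑ w ∈ (range (k+1)).image ord, (m v w : ℤ) :=
        Finset.sum_nonneg (by intros; positivity)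
      have hu := hup v hv
      split_ifs with hc
      · simp only [mem_image, mem_range] at hc
        obtain ⟨i, hik, rfl⟩ := hc
        have hi0 : i ≠ 0 := by rintro rfl; exact hv h0
        have h1 := hD i (by omega) (by omega)
        have h2 : ∑ w ∈ (range i).image ord, (m (ord i) w : ℤ) ≤
            ∑ w ∈ (range (k+1)).image ord, (m (ord i) w : ℤ) :=
          Finset.sum_le_sum_of_subset_of_nonneg
            (Finset.image_subset_image (Finset.range_mono (by omega))) (by intros; positivity)
        omega
      · omega
  · rintro ⟨ord, h0, hbij, hb, hc⟩
    refine ⟨fun v hv => ?_, fun A hA hvA => ?_⟩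
    · have := (hb v hv).2
      dsimp only at this
      omega
    · classical
      have hex : ∃ i, i < Fintype.card V ∧ ord i ∈ A := by
        obtain ⟨a, ha⟩ := hA
        obtain ⟨i, ⟨hi, rfl⟩, -⟩ := hbij a
        exact ⟨i, hi, ha⟩
      obtain ⟨hk, hkA⟩ := Nat.find_spec hex
      have hmin : ∀ j < Nat.find hex, ord j ∉ A := fun j hj hjA =>
        Nat.find_min hex hj ⟨by omega, hjA⟩
      generalize Nat.find hex = k at hk hkA hmin
      have hk0 : k ≠ 0 := by rintro rfl; exact hvA (h0 ▸ hkA)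
      have hv : ord k ≠ v0 := by intro h; exact hvA (h ▸ hkA)
      have h1 := hc k (by omega) (by omega) (ord k) hv
      rw [aux_lap m ord D k (ord k), if_pos (Finset.mem_image_of_mem _ (by simp))] at h1
      swap
      · intro w; simp [Order.lt_add_one_iff]
      refine ⟨ord k, hkA, ?_⟩
      have h2 : ∑ w ∈ (range (k+1)).image ord, (m (ord k) w : ℤ) ≤ ∑ w ∈ Aᶜ, (m (ord k) w : ℤ) := by
        rw [Finset.range_add_one, Finset.image_insert]
        have h3 : ∑ w ∈ insert (ord k) ((range k).image ord), (m (ord k) w : ℤ)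
            = ∑ w ∈ (range k).image ord, (m (ord k) w : ℤ) :=
          Finset.sum_insert_of_eq_zero_if_notMem (by intro _; simp [hloop])
        rw [h3]
        apply Finset.sum_le_sum_of_subset_of_nonneg
        · intro w hw
          simp only [mem_image, mem_range] at hw
          obtain ⟨j, hj, rfl⟩ := hw
          simpa using hmin j hj
        · intros; positivity
      rw [outdeg]; push_cast; omega
end

section
/- If a graph G is (k+1)-edge-connected (k ≥ 1) and v0 ∈ V(G) is any vertex, then every effective divisor of degree k on G is v0-reduced; consequently, no two distinct effective divisors of degree k on G are linearly equivalent. -/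
open Finset

variable {V : Type}

/-- `m` is `j`-edge-connected: removing any set of at most `j - 1` edges
(given by a symmetric submultiplicity function `w`, the number of removed edges being
`(∑ u, ∑ v, w u v) / 2`) leaves a connected graph. -/
def EdgeConnected [Fintype V] (m : V → V → ℕ) (j : ℕ) : Prop :=
  ∀ w : V → V → ℕ, (∀ u v, w u v = w v u) → (∀ u v, w u v ≤ m u v) →
    (∑ u, ∑ v, w u v) ≤ 2 * (j - 1) →
    (SimpleGraph.fromRel (fun u v => w u v < m u v)).Connected

theorem cut_bound [Fintype V] [DecidableEq V]
    (m : V → V → ℕ) (hm : IsGraph m) (k : ℕ)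
    (hec : EdgeConnected m (k + 1)) (A : Finset V) (v0 : V) (hA : A.Nonempty) (h0 : v0 ∉ A) :
    k < ∑ v ∈ A, outdeg m A v := by
  by_contra hlt
  have hle : ∑ v ∈ A, outdeg m A v ≤ k := not_lt.mp hlt
  obtain ⟨hs, -, -⟩ := hm
  have hcon := hec (fun u v => if (u ∈ A ↔ v ∈ A) then 0 else m u v)
    (by intro u v; simp only [iff_comm, hs u v]) (by intro u v; split_ifs <;> simp)
    (by
      have e1 : ∀ u ∈ A, ∑ v, (if (u ∈ A ↔ v ∈ A) then 0 else m u v) = ∑ v ∈ Aᶜ, m u v := by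
        intro u hu
        rw [← Finset.sum_add_sum_compl A, Finset.sum_eq_zero, zero_add]
        · apply Finset.sum_congr rfl
          intro v hv
          simp only [Finset.mem_compl] at hv
          simp [hu, hv]
        · intro v hv
          simp [hu, hv]
      have e2 : ∀ u ∈ Aᶜ, ∑ v, (if (u ∈ A ↔ v ∈ A) then 0 else m u v) = ∑ v ∈ A, m v u := by
        intro u hu
        simp only [Finset.mem_compl] at hu
        rw [← Finset.sum_add_sum_compl A, add_comm, Finset.sum_eq_zero, zero_add]
        · apply Finset.sum_congr rfl
          intro v hv
          simp [hu, hv, hs u v]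
        · intro v hv
          simp only [Finset.mem_compl] at hv
          simp [hu, hv]
      rw [← Finset.sum_add_sum_compl A, Finset.sum_congr rfl e1, Finset.sum_congr rfl e2,
        Finset.sum_comm (s := Aᶜ)]
      unfold outdeg at hle
      omega)
  obtain ⟨a, ha⟩ := hA
  have key : ∀ x y, (SimpleGraph.fromRel
      (fun u v => (if (u ∈ A ↔ v ∈ A) then 0 else m u v) < m u v)).Walk x y → x ∈ A → y ∈ A := by
    intro x y p
    induction p with
    | nil => exact id
    | cons h _ ih =>
      intro hx
      apply ih
      by_contra hy
      simp [SimpleGraph.fromRel_adj, hx, hy] at h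
  obtain ⟨p⟩ := hcon.preconnected a v0
  exact h0 (key _ _ p ha)

theorem exists_lt_outdeg [Fintype V] [DecidableEq V]
    (m : V → V → ℕ) (hm : IsGraph m) (k : ℕ)
    (hec : EdgeConnected m (k + 1)) (A : Finset V) (v0 : V) (hA : A.Nonempty) (h0 : v0 ∉ A)
    (D : V → ℤ) (hD : Effective D) (hd : divDeg D = (k : ℤ)) :
    ∃ v ∈ A, D v < (outdeg m A v : ℤ) := by
  by_contra! h
  have h1 := cut_bound m hm k hec A v0 hA h0
  have h2 := Finset.sum_le_sum h
  have h3 : ∑ v ∈ A, D v ≤ ∑ v, D v :=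
    Finset.sum_le_sum_of_subset_of_nonneg (Finset.subset_univ A) (fun i _ _ => hD i)
  unfold divDeg at hd
  have h4 : (k : ℤ) < ∑ v ∈ A, (outdeg m A v : ℤ) := by exact_mod_cast h1
  linarith

theorem edgeConnected_effective_reduced [Fintype V] [DecidableEq V]
    (m : V → V → ℕ) (hm : IsGraph m) (k : ℕ) (hk : 1 ≤ k)
    (hec : EdgeConnected m (k + 1)) (v0 : V) :
    (∀ D : V → ℤ, Effective D → divDeg D = (k : ℤ) → Reduced m v0 D) ∧
    (∀ D D' : V → ℤ, Effective D → divDeg D = (k : ℤ) →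
      Effective D' → divDeg D' = (k : ℤ) → LinEquiv m D D' → D = D') := by 
  refine ⟨fun D hD hd => ⟨fun v _ => hD v, fun A hA h0 =>
    exists_lt_outdeg m hm k hec A v0 hA h0 D hD hd⟩, ?_⟩
  rintro D D' hD hd hD' - ⟨f, hf⟩
  obtain ⟨a, -, ha⟩ := Finset.exists_max_image Finset.univ f ⟨v0, Finset.mem_univ _⟩
  have lap : ∀ v, D v - D' v = ∑ w, (m v w : ℤ) * (f v - f w) := by
    intro v
    have := congrFun hf v
    simp only [Pi.sub_apply, laplacian, mdeg] at this
    rw [this]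
    push_cast
    rw [Finset.sum_mul, ← Finset.sum_sub_distrib]
    exact Finset.sum_congr rfl (fun w _ => by ring)
  by_cases hc : ∀ v, f v = f a
  · funext v
    have := lap v
    simp only [hc, sub_self, mul_zero, Finset.sum_const_zero] at this
    linarith
  · exfalso
    push Not at hc
    obtain ⟨b, hb⟩ := hc
    obtain ⟨v, hv, hlt⟩ := exists_lt_outdeg m hm k hec (Finset.univ.filter (fun v => f v = f a)) b
      ⟨a, by simp⟩ (by simpa using hb) D hD hd
    have hva : f v = f a := by simpa using hv
    have h1 : (outdeg m (Finset.univ.filter (fun v => f v = f a)) v : ℤ)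
        ≤ ∑ w, (m v w : ℤ) * (f v - f w) := by
      unfold outdeg
      push_cast
      refine le_trans (Finset.sum_le_sum (g := fun w => (m v w : ℤ) * (f v - f w)) ?_)
        (Finset.sum_le_sum_of_subset_of_nonneg (Finset.subset_univ _) ?_)
      · intro w hw
        have hw' : f w ≠ f a := by simpa using hw
        have := lt_of_le_of_ne (ha w (Finset.mem_univ _)) hw'
        exact le_mul_of_one_le_right (by positivity) (by omega)
      · intro w _ _
        have := ha w (Finset.mem_univ _)
        exact mul_nonneg (by positivity) (by omega)
    have := lap v
    have := hD' v
    linarith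
end

section
/- In the abstract setting (X a nonempty set, ∼ an equivalence relation on Div(X) satisfying (E1) and (E2), g ≥ 0 an integer, K ∈ Div(X) of degree 2g−2), property (RR2) — for every D ∈ Div(X) with deg(D) = g − 1, ε(D) + ε(K − D) = 0 — holds if and only if r(K) ≥ g − 1. -/
variable {X : Type}

/-- Degree of a divisor on the set `X` (an element of the free abelian group on `X`). -/
def adeg (D : X →₀ ℤ) : ℤ := D.sum fun _ a => a

/-- A divisor is effective if all its coefficients are nonnegative. -/
def AEff (D : X →₀ ℤ) : Prop := ∀ x, 0 ≤ D x

/-- `|D| ≠ ∅`: some effective divisor is equivalent to `D`. -/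
def AWin (R : (X →₀ ℤ) → (X →₀ ℤ) → Prop) (D : X →₀ ℤ) : Prop := ∃ E, AEff E ∧ R D E

/-- The rank `r(D)` of the linear system of a divisor: the largest `s ≥ -1` such that
`|D - E| ≠ ∅` for every effective divisor `E` of degree `s`. -/
noncomputable def arank (R : (X →₀ ℤ) → (X →₀ ℤ) → Prop) (D : X →₀ ℤ) : ℤ :=
  sSup {s : ℤ | s = -1 ∨ (0 ≤ s ∧ ∀ E : X →₀ ℤ, AEff E → adeg E = s → AWin R (D - E))}

open Classical in
/-- `ε(D) = 0` if `|D| ≠ ∅` and `ε(D) = 1` if `|D| = ∅`. -/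
noncomputable def eps (R : (X →₀ ℤ) → (X →₀ ℤ) → Prop) (D : X →₀ ℤ) : ZMod 2 :=
  if AWin R D then 0 else 1

/-- The set `𝒩` of divisors of degree `g - 1` with empty linear system. -/
def NSet (R : (X →₀ ℤ) → (X →₀ ℤ) → Prop) (g : ℕ) : Set (X →₀ ℤ) :=
  {D | adeg D = (g : ℤ) - 1 ∧ ¬ AWin R D}

theorem adeg_add' (D E : X →₀ ℤ) : adeg (D + E) = adeg D + adeg E := by
  unfold adeg
  exact Finsupp.sum_add_index' (fun _ => rfl) (fun _ _ _ => rfl)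

theorem adeg_sub' (D E : X →₀ ℤ) : adeg (D - E) = adeg D - adeg E := by
  have h := adeg_add' (D - E) E
  rw [sub_add_cancel] at h
  omega

theorem adeg_single' (x : X) (s : ℤ) : adeg (Finsupp.single x s) = s := by
  unfold adeg
  exact Finsupp.sum_single_index rfl

theorem adeg_nonneg' (D : X →₀ ℤ) (h : AEff D) : 0 ≤ adeg D :=
  Finset.sum_nonneg fun x _ => h x

theorem aeff_single' (x : X) (s : ℤ) (hs : 0 ≤ s) : AEff (Finsupp.single x s) := by
  classical
  intro y
  rw [Finsupp.single_apply]
  split_ifs <;> omega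

theorem aeff_add' (D E : X →₀ ℤ) (hD : AEff D) (hE : AEff E) : AEff (D + E) := by
  intro y
  exact add_nonneg (hD y) (hE y)

theorem rr2_iff_rank_canonical [Nonempty X] (R : (X →₀ ℤ) → (X →₀ ℤ) → Prop)
    (hequiv : Equivalence R)
    (hE1 : ∀ D D', R D D' → adeg D = adeg D')
    (hE2 : ∀ D₁ D₁' D₂ D₂', R D₁ D₁' → R D₂ D₂' → R (D₁ + D₂) (D₁' + D₂'))
    (g : ℕ) (K : X →₀ ℤ) (hK : adeg K = 2 * (g : ℤ) - 2) :
    (∀ D : X →₀ ℤ, adeg D = (g : ℤ) - 1 → eps R D + eps R (K - D) = 0) ↔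
      (g : ℤ) - 1 ≤ arank R K := by
  classical
  obtain ⟨x⟩ := ‹Nonempty X›
  have hwin : ∀ D, AWin R D → 0 ≤ adeg D := by
    rintro D ⟨E, hE, hR⟩
    rw [hE1 _ _ hR]
    exact adeg_nonneg' E hE
  have hbdd : BddAbove {s : ℤ | s = -1 ∨ (0 ≤ s ∧ ∀ E : X →₀ ℤ, AEff E → adeg E = s →
      AWin R (K - E))} := by
    refine ⟨max (-1) (adeg K), ?_⟩
    rintro s (hs | ⟨hs, h⟩)
    · exact hs ▸ le_max_left _ _
    · have := hwin _ (h _ (aeff_single' x s hs) (adeg_single' x s))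
      rw [adeg_sub', adeg_single'] at this
      exact le_max_of_le_right (by omega)
  constructor
  · intro h
    refine le_csSup hbdd ?_
    rcases Nat.eq_zero_or_pos g with hg | hg
    · left; simp [hg]
    · right
      refine ⟨by omega, fun E hE hd => ?_⟩
      have h1 := h E hd
      have h2 : AWin R E := ⟨E, hE, hequiv.refl E⟩
      by_contra h3
      simp [eps, h2, h3] at h1
  · intro h D hD
    have key : AWin R D ↔ AWin R (K - D) := by
      rcases Nat.eq_zero_or_pos g with hg | hg
      · constructor
        · intro h1
          have := hwin _ h1
          omega
        · intro h1
          have := hwin _ h1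
          rw [adeg_sub'] at this
          omega
      · have hmem := Int.csSup_mem ⟨-1, Or.inl rfl⟩ hbdd
        change arank R K = -1 ∨ (0 ≤ arank R K ∧ ∀ E : X →₀ ℤ, AEff E → adeg E = arank R K →
          AWin R (K - E)) at hmem
        rcases hmem with hmem | ⟨h0, hmem⟩
        · omega
        have main : ∀ D, adeg D = (g : ℤ) - 1 → AWin R D → AWin R (K - D) := by
          rintro D hD ⟨E, hE, hR⟩
          have hk : 0 ≤ arank R K - ((g : ℤ) - 1) := by omega
          have hdE := hE1 _ _ hR
          set P : X →₀ ℤ := Finsupp.single x (arank R K - ((g : ℤ) - 1)) with hP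
          have hPe : AEff P := aeff_single' x _ hk
          obtain ⟨F, hF, hRF⟩ := hmem (E + P) (aeff_add' _ _ hE hPe)
            (by rw [adeg_add', hP, adeg_single']; omega)
          refine ⟨F + P, aeff_add' _ _ hF hPe, ?_⟩
          have h1 := hE2 _ _ _ _ hRF (hequiv.refl P)
          have h2 := hE2 _ _ _ _ hR (hequiv.refl (K - D - E))
          have e1 : K - (E + P) + P = K - E := by abel
          have e2 : D + (K - D - E) = K - E := by abel
          have e3 : E + (K - D - E) = K - D := by abel
          rw [e1] at h1
          rw [e2, e3] at h2
          exact hequiv.trans (hequiv.symm h2) h1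
        refine ⟨main D hD, fun h1 => ?_⟩
        have := main (K - D) (by rw [adeg_sub']; omega) h1
        rwa [sub_sub_cancel] at this
    by_cases h1 : AWin R D
    · simp [eps, h1, key.1 h1]
    · have h2 : ¬ AWin R (K - D) := fun h2 => h1 (key.2 h2)
      simp only [eps, h1, h2, if_false]
      decide
end
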